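/- For every integer d ≥ 2 there exists a connected simple graph X of bounded degree with polynomial growth of degree d (graph distance, counting measure) and an increasing sequence of integers N_n → ∞ such that I(N_n) = o(I^↓_C(N_n)), i.e. I(N_n)/I^↓_C(N_n) → 0 as n → ∞, where I is the isoperimetric profile of X and I^↓_C is the profile restricted to connected subsets. In particular, connected subsets of X are not asymptotically isoperimetric. -/

import Mathlib

open SimpleGraph Set Filter

noncomputable section

/-- The ball of center `x` and radius `r` for the graph distance. -/
def gBall {V : Type*} (G : SimpleGraph V) (x : V) (r : ℕ) : Set V := {y | G.dist x y ≤ r}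

/-- The boundary `∂A = {y : d(y,A) ≤ 1 and d(y,Aᶜ) ≤ 1}` of a set of vertices. -/
def gBdry {V : Type*} (G : SimpleGraph V) (A : Set V) : Set V :=
  {y | (∃ a ∈ A, G.dist y a ≤ 1) ∧ ∃ a ∈ Aᶜ, G.dist y a ≤ 1}

/-- `G` has bounded degree. -/
def BddDegree {V : Type*} (G : SimpleGraph V) : Prop :=
  ∃ D : ℕ, ∀ v : V, (G.neighborSet v).ncard ≤ D

/-- `G` has polynomial growth of degree `d`. -/
def PolyGrowth {V : Type*} (G : SimpleGraph V) (d : ℕ) : Prop :=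
  ∃ C : ℝ, 1 ≤ C ∧ ∀ (x : V) (r : ℕ), 1 ≤ r →
    C⁻¹ * (r : ℝ) ^ d ≤ ((gBall G x r).ncard : ℝ) ∧
    ((gBall G x r).ncard : ℝ) ≤ C * (r : ℝ) ^ d

/-- A vertex set is (metrically) connected: there is no nontrivial partition
`A = A₁ ⊔ A₂` with `d(A₁, A₂) ≥ 10`. -/
def gConn {V : Type*} (G : SimpleGraph V) (A : Set V) : Prop :=
  ∀ A₁ A₂ : Set V, A = A₁ ∪ A₂ → Disjoint A₁ A₂ →
    (∀ x ∈ A₁, ∀ y ∈ A₂, 10 ≤ G.dist x y) → A₁ = ∅ ∨ A₂ = ∅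

/-- The isoperimetric profile `I(t) = inf {|∂A| : A finite, |A| ≥ t}`. -/
def gProfile {V : Type*} (G : SimpleGraph V) (t : ℕ) : ℕ :=
  sInf {m : ℕ | ∃ A : Set V, A.Finite ∧ t ≤ A.ncard ∧ (gBdry G A).ncard = m}

/-- The isoperimetric profile restricted to connected sets. -/
def gConnProfile {V : Type*} (G : SimpleGraph V) (t : ℕ) : ℕ :=
  sInf {m : ℕ | ∃ A : Set V, A.Finite ∧ gConn G A ∧ t ≤ A.ncard ∧ (gBdry G A).ncard = m}


/-- Side length (and position) of the blob of level `n`. -/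
def ee (d n : ℕ) : ℕ := 10 * ((n + 2).factorial) ^ d

lemma ee_step (d n : ℕ) (hd : 2 ≤ d) :
    2 * ee d n + 10 * ((n + 2).factorial) ^ d ≤ ee d (n + 1) := by
  unfold ee
  have h : (n + 1 + 2).factorial = (n + 3) * (n + 2).factorial := rfl
  rw [h, mul_pow]
  have h3 : 3 ≤ (n + 3) ^ d := by
    calc 3 ≤ n + 3 := by omega
      _ = (n + 3) ^ 1 := by ring
      _ ≤ (n + 3) ^ d := Nat.pow_le_pow_right (by omega) (by omega)
  have := Nat.mul_le_mul_right ((n + 2).factorial ^ d) h3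
  omega

lemma ee_mono (d : ℕ) : Monotone (ee d) := by
  intro a b h
  unfold ee
  have : (a + 2).factorial ≤ (b + 2).factorial := Nat.factorial_le (by omega)
  gcongr

lemma ee_gap (d l m : ℕ) (hd : 2 ≤ d) (h : l < m) :
    2 * ee d l + 10 * ((m + 1).factorial) ^ d ≤ ee d m := by
  obtain ⟨k, rfl⟩ : ∃ k, m = k + 1 := ⟨m - 1, by omega⟩
  have h1 := ee_step d k hd
  have h2 := ee_mono d (show l ≤ k by omega)
  have : k + 1 + 1 = k + 2 := rfl
  rw [this]
  omega

lemma fac_le_ee (d n : ℕ) (hd : 2 ≤ d) : (n + 2).factorial ≤ ee d n := by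
  unfold ee
  have h : (n + 2).factorial ^ 1 ≤ (n + 2).factorial ^ d :=
    Nat.pow_le_pow_right (Nat.factorial_pos _) (by omega)
  rw [pow_one] at h
  omega

lemma ee_pos (d n : ℕ) (hd : 2 ≤ d) : 0 < ee d n :=
  lt_of_lt_of_le (Nat.factorial_pos _) (fac_le_ee d n hd)

/-- Admissible vertices: level `0` is the full lattice, level `n ≥ 1` is a cube. -/
def okV (d : ℕ) (v : (Fin d → ℤ) × ℕ) : Prop :=
  v.2 ≠ 0 → ∀ i, (ee d v.2 : ℤ) ≤ v.1 i ∧ v.1 i < 2 * (ee d v.2 : ℤ)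

abbrev VV (d : ℕ) : Type := {v : (Fin d → ℤ) × ℕ // okV d v}

/-- Door points of level `l`. -/
def isDoor (d : ℕ) (x : Fin d → ℤ) (l : ℕ) : Prop :=
  ∃ t : ℕ, t < l.factorial ∧ ∀ i, x i = (ee d l : ℤ) + t

def GG (d : ℕ) : SimpleGraph (VV d) where
  Adj u v := u ≠ v ∧ ((u.1.2 = v.1.2 ∧ ∀ i, |u.1.1 i - v.1.1 i| ≤ 1) ∨
    (u.1.1 = v.1.1 ∧ ((u.1.2 = 0 ∧ isDoor d u.1.1 v.1.2) ∨ (v.1.2 = 0 ∧ isDoor d v.1.1 u.1.2))))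
  symm := ⟨by
    rintro u v ⟨h, h'⟩
    refine ⟨h.symm, ?_⟩
    rcases h' with ⟨h1, h2⟩ | ⟨h1, h2⟩
    · left
      refine ⟨h1.symm, fun i => ?_⟩
      rw [abs_sub_comm]; exact h2 i
    · right
      exact ⟨h1.symm, h2.symm⟩⟩
  loopless := ⟨fun u h => h.1 rfl⟩

/-- Sets closed under taking coordinatewise intermediate points. -/
def BoxConvex {d : ℕ} (P : (Fin d → ℤ) → Prop) : Prop :=
  ∀ x y z : Fin d → ℤ, P x → P y → (∀ i, (x i ≤ z i ∧ z i ≤ y i) ∨ (y i ≤ z i ∧ z i ≤ x i)) → P z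

lemma box_walk {d : ℕ} (P : (Fin d → ℤ) → Prop) (hP : BoxConvex P) (l : ℕ)
    (hok : ∀ x, P x → okV d (x, l)) (r : ℕ) :
    ∀ (x y : Fin d → ℤ) (hx : P x) (hy : P y), (∀ i, |x i - y i| ≤ r) →
      ∃ w : (GG d).Walk ⟨(x, l), hok x hx⟩ ⟨(y, l), hok y hy⟩, w.length ≤ r ∧
        ∀ z ∈ w.support, z.1.2 = l ∧ P z.1.1 := by
  induction r with
  | zero =>
    intro x y hx hy h
    have : x = y := by
      funext i
      have := h i
      rw [abs_le] at this
      push_cast at this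
      omega
    subst this
    refine ⟨Walk.nil, by simp, ?_⟩
    intro z hz
    simp at hz
    subst hz
    exact ⟨rfl, hx⟩
  | succ r ih =>
    intro x y hx hy h
    let z : Fin d → ℤ := fun i => if x i < y i then x i + 1 else if y i < x i then x i - 1 else x i
    have hz : P z := by
      refine hP x y z hx hy fun i => ?_
      simp only [z]
      split_ifs <;> omega
    have hzy : ∀ i, |z i - y i| ≤ r := by
      intro i
      have := h i
      rw [abs_le] at this ⊢
      push_cast at this
      simp only [z]
      split_ifs <;> omega
    obtain ⟨w, hw, hw'⟩ := ih z y hz hy hzy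
    by_cases hxz : x = z
    · have hs : (⟨(x, l), hok x hx⟩ : VV d) = ⟨(z, l), hok z hz⟩ := by
        apply Subtype.ext; simp [← hxz]
      rw [hs]
      exact ⟨w, by omega, hw'⟩
    · have hadj : (GG d).Adj ⟨(x, l), hok x hx⟩ ⟨(z, l), hok z hz⟩ := by
        refine ⟨?_, Or.inl ⟨rfl, fun i => ?_⟩⟩
        · intro h
          apply hxz
          exact congrArg (fun v : VV d => v.1.1) h
        · rw [abs_le]
          simp only [z]
          split_ifs <;> omega
      refine ⟨Walk.cons hadj w, by simp [hw], ?_⟩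
      intro q hq
      rw [Walk.support_cons, List.mem_cons] at hq
      rcases hq with rfl | hq
      · exact ⟨rfl, hx⟩
      · exact hw' q hq

lemma walk_bdry {V : Type*} (G : SimpleGraph V) (A : Set V) {u v : V} (w : G.Walk u v)
    (hu : u ∈ A) (h : ∀ z ∈ w.support, z ∉ gBdry G A) : v ∈ A := by
  induction w with
  | nil => exact hu
  | @cons u v x hadj w ih =>
    apply ih
    · by_contra hv
      apply h u (by simp)
      refine ⟨⟨u, hu, by simp⟩, ⟨v, hv, ?_⟩⟩
      rw [SimpleGraph.dist_eq_one_iff_adj.mpr hadj]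
    · intro z hz
      exact h z (by simp [hz])

/-- If a boxconvex set in one level misses the boundary and meets `A`, it is in `A`. -/
lemma box_fill {d : ℕ} (P : (Fin d → ℤ) → Prop) (hP : BoxConvex P) (l : ℕ)
    (hok : ∀ x, P x → okV d (x, l)) (A : Set (VV d))
    (hb : ∀ z : VV d, z.1.2 = l → P z.1.1 → z ∉ gBdry (GG d) A)
    (x y : Fin d → ℤ) (hx : P x) (hy : P y) (hA : (⟨(x, l), hok x hx⟩ : VV d) ∈ A) :
    (⟨(y, l), hok y hy⟩ : VV d) ∈ A := by
  obtain ⟨w, -, hw⟩ := box_walk P hP l hok (∑ i, (x i - y i).natAbs) x y hx hy (by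
    intro i
    rw [Int.abs_eq_natAbs]
    exact_mod_cast Finset.single_le_sum (f := fun i => (x i - y i).natAbs)
      (fun _ _ => Nat.zero_le _) (Finset.mem_univ i))
  exact walk_bdry _ A w hA fun z hz => hb z (hw z hz).1 (hw z hz).2

lemma ok_zero {d : ℕ} (x : Fin d → ℤ) : okV d (x, 0) := fun h => absurd rfl h

/-- Base vertex. -/
def bv {d : ℕ} (x : Fin d → ℤ) : VV d := ⟨(x, 0), ok_zero x⟩

lemma dist_base {d : ℕ} (x y : Fin d → ℤ) (r : ℕ) (h : ∀ i, |x i - y i| ≤ r) :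
    ∃ w : (GG d).Walk (bv x) (bv y), w.length ≤ r := by
  obtain ⟨w, hw, -⟩ := box_walk (fun _ => True) (fun _ _ _ _ _ _ => trivial) 0
    (fun x _ => ok_zero x) r x y trivial trivial h
  exact ⟨w, hw⟩

lemma okBox_convex (d l : ℕ) : BoxConvex (fun x => okV d (x, l)) := by
  intro x y z hx hy h hl i
  have h1 := hx hl i
  have h2 := hy hl i
  have h3 := h i
  simp only at *
  omega

lemma dist_level {d : ℕ} (u v : VV d) (hl : u.1.2 = v.1.2) (r : ℕ)
    (h : ∀ i, |u.1.1 i - v.1.1 i| ≤ r) :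
    ∃ w : (GG d).Walk u v, w.length ≤ r := by
  obtain ⟨⟨x, l⟩, hx⟩ := u
  obtain ⟨⟨y, l'⟩, hy⟩ := v
  simp only at hl h
  subst hl
  obtain ⟨w, hw, -⟩ := box_walk (fun x => okV d (x, l)) (okBox_convex d l) l
    (fun x h => h) r x y hx hy h
  exact ⟨w, hw⟩

lemma door_ok {d : ℕ} (hd : 2 ≤ d) (l t : ℕ) (ht : t < l.factorial) :
    okV d (fun _ => (ee d l : ℤ) + t, l) := by
  intro _ i
  have h1 := fac_le_ee d l hd
  have h2 : l.factorial ≤ (l + 2).factorial := Nat.factorial_le (by omega)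
  simp only
  omega

lemma door_adj {d : ℕ} (hd : 2 ≤ d) (l t : ℕ) (hl : l ≠ 0) (ht : t < l.factorial) :
    (GG d).Adj ⟨(fun _ => (ee d l : ℤ) + t, l), door_ok hd l t ht⟩
      (bv (fun _ => (ee d l : ℤ) + t)) := by
  refine ⟨?_, Or.inr ⟨rfl, Or.inr ⟨rfl, t, ht, fun _ => rfl⟩⟩⟩
  intro h
  exact hl (congrArg (fun v : VV d => v.1.2) h)

/-- From a vertex at level `l ≠ 0` one gets to the base in at most `ee + 1` steps. -/
lemma to_base {d : ℕ} (hd : 2 ≤ d) (u : VV d) (hl : u.1.2 ≠ 0) :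
    ∃ w : (GG d).Walk u (bv (fun _ => (ee d u.1.2 : ℤ))), w.length ≤ ee d u.1.2 + 1 := by
  have ht : 0 < u.1.2.factorial := Nat.factorial_pos _
  obtain ⟨w, hw⟩ := dist_level u ⟨(fun _ => (ee d u.1.2 : ℤ) + (0 : ℕ), u.1.2),
    door_ok hd u.1.2 0 ht⟩ rfl (ee d u.1.2) (by
      intro i
      have := u.2 hl i
      rw [abs_le]
      simp only [Nat.cast_zero]
      omega)
  have ha := door_adj hd u.1.2 0 hl ht
  have e : (fun _ => (ee d u.1.2 : ℤ) + (0 : ℕ) : Fin d → ℤ) = fun _ => (ee d u.1.2 : ℤ) := by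
    simp
  have : (bv (fun _ => (ee d u.1.2 : ℤ) + (0 : ℕ)) : VV d) = bv (fun _ => (ee d u.1.2 : ℤ)) := by
    rw [e]
  rw [← this]
  refine ⟨w.append (Walk.cons ha Walk.nil), ?_⟩
  rw [Walk.length_append]
  simp
  exact hw

lemma reach_base {d : ℕ} (x y : Fin d → ℤ) : (GG d).Reachable (bv x) (bv y) := by
  obtain ⟨w, -⟩ := dist_base x y (∑ i, (x i - y i).natAbs) (by
    intro i
    rw [Int.abs_eq_natAbs]
    exact_mod_cast Finset.single_le_sum (f := fun i => (x i - y i).natAbs)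
      (fun _ _ => Nat.zero_le _) (Finset.mem_univ i))
  exact ⟨w⟩

lemma reach_origin {d : ℕ} (hd : 2 ≤ d) (u : VV d) : (GG d).Reachable u (bv 0) := by
  by_cases hl : u.1.2 = 0
  · obtain ⟨⟨x, l⟩, hx⟩ := u
    simp only at hl
    subst hl
    exact reach_base x 0
  · obtain ⟨w, -⟩ := to_base hd u hl
    exact Reachable.trans ⟨w⟩ (reach_base _ _)

lemma GG_connected {d : ℕ} (hd : 2 ≤ d) : (GG d).Connected := by
  have : Nonempty (VV d) := ⟨bv 0⟩
  exact ⟨fun u v => (reach_origin hd u).trans (reach_origin hd v).symm⟩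

lemma walk_lip {d : ℕ} {u v : VV d} (w : (GG d).Walk u v) (i : Fin d) :
    |u.1.1 i - v.1.1 i| ≤ w.length := by
  induction w with
  | nil => simp
  | @cons u v x hadj w ih =>
    have h1 : |u.1.1 i - v.1.1 i| ≤ 1 := by
      rcases hadj.2 with ⟨-, h⟩ | ⟨h, -⟩
      · exact h i
      · rw [h]; simp
    rw [Walk.length_cons]
    push_cast
    rw [abs_le] at *
    omega

lemma dist_lip {d : ℕ} (hd : 2 ≤ d) (u v : VV d) (i : Fin d) :
    |u.1.1 i - v.1.1 i| ≤ (GG d).dist u v := by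
  obtain ⟨w, hw⟩ := (GG_connected hd).exists_walk_length_eq_dist u v
  rw [← hw]
  exact walk_lip w i

lemma count_up {d : ℕ} (B : Set (VV d)) (hinj : InjOn (fun v : VV d => v.1.1) B)
    (a : Fin d → ℤ) (s : ℕ) (h : ∀ v ∈ B, ∀ i, a i ≤ v.1.1 i ∧ v.1.1 i < a i + s) :
    B.Finite ∧ B.ncard ≤ s ^ d := by
  classical
  let F : Finset (Fin d → ℤ) := Fintype.piFinset fun i => Finset.Ico (a i) (a i + s)
  have hF : F.card = s ^ d := by simp [F, Fintype.card_piFinset]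
  have hmaps : ∀ v ∈ B, v.1.1 ∈ (F : Set (Fin d → ℤ)) := by
    intro v hv
    simp only [F, Finset.mem_coe, Fintype.mem_piFinset, Finset.mem_Ico]
    exact h v hv
  constructor
  · exact Set.Finite.of_injOn hmaps hinj F.finite_toSet
  · rw [← hF, ← Set.ncard_coe_finset]
    exact Set.ncard_le_ncard_of_injOn _ hmaps hinj F.finite_toSet

lemma count_low {d : ℕ} (B : Set (VV d)) (hB : B.Finite) (l : ℕ)
    (a : Fin d → ℤ) (s : ℕ) (h : ∀ y : Fin d → ℤ, (∀ i, a i ≤ y i ∧ y i < a i + s) →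
      ∃ hy : okV d (y, l), (⟨(y, l), hy⟩ : VV d) ∈ B) :
    s ^ d ≤ B.ncard := by
  classical
  let F : Finset (Fin d → ℤ) := Fintype.piFinset fun i => Finset.Ico (a i) (a i + s)
  have hF : F.card = s ^ d := by simp [F, Fintype.card_piFinset]
  have hsub : (F : Set (Fin d → ℤ)) ⊆ (fun v : VV d => v.1.1) '' B := by
    intro y hy
    simp only [F, Finset.mem_coe, Fintype.mem_piFinset, Finset.mem_Ico] at hy
    obtain ⟨hy', hm⟩ := h y hy
    exact ⟨_, hm, rfl⟩
  rw [← hF, ← Set.ncard_coe_finset]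
  exact (Set.ncard_le_ncard hsub (hB.image _)).trans (Set.ncard_image_le hB)

lemma count_disj {V ι : Type*} (T : Finset ι) (S : Set V) (hS : S.Finite) (P : ι → V → Prop)
    (h : ∀ t ∈ T, ∃ v ∈ S, P t v) (hd : ∀ t t' v, P t v → P t' v → t = t') :
    T.card ≤ S.ncard := by
  classical
  rcases T.eq_empty_or_nonempty with rfl | ⟨t0, ht0⟩
  · simp
  have : Nonempty V := ⟨(h t0 ht0).choose⟩
  choose! f hf hf' using h
  rw [← Set.ncard_coe_finset]
  refine Set.ncard_le_ncard_of_injOn f (fun t ht => hf t ht) ?_ hS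
  intro t ht t' ht' he
  exact hd t t' (f t) (hf' t ht) (he ▸ hf' t' ht')

lemma inj_zero {d : ℕ} (B : Set (VV d)) (l : ℕ) (h : ∀ v ∈ B, v.1.2 = l) :
    InjOn (fun v : VV d => v.1.1) B := by
  intro u hu v hv he
  exact Subtype.ext (Prod.ext he ((h u hu).trans (h v hv).symm))

lemma inj_pos {d : ℕ} (hd : 2 ≤ d) (B : Set (VV d)) (h : ∀ v ∈ B, v.1.2 ≠ 0) :
    InjOn (fun v : VV d => v.1.1) B := by
  intro u hu v hv he
  simp only at he
  refine Subtype.ext (Prod.ext he ?_)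
  have h1 := u.2 (h u hu) ⟨0, by omega⟩
  have h2 := v.2 (h v hv) ⟨0, by omega⟩
  rw [he] at h1
  rcases lt_trichotomy u.1.2 v.1.2 with hlt | heq | hlt
  · have := ee_gap d _ _ hd hlt
    omega
  · exact heq
  · have := ee_gap d _ _ hd hlt
    omega

lemma ball_up {d : ℕ} (hd : 2 ≤ d) (x : VV d) (r : ℕ) :
    (gBall (GG d) x r).Finite ∧ (gBall (GG d) x r).ncard ≤ 2 * (2 * r + 1) ^ d := by
  have hc : ∀ v ∈ gBall (GG d) x r, ∀ i, x.1.1 i - r ≤ v.1.1 i ∧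
      v.1.1 i < x.1.1 i - r + (2 * r + 1 : ℕ) := by
    intro v hv i
    have h1 := dist_lip hd x v i
    have h2 : (GG d).dist x v ≤ r := hv
    rw [abs_le] at h1
    push_cast
    omega
  have e : gBall (GG d) x r = {v ∈ gBall (GG d) x r | v.1.2 = 0} ∪
      {v ∈ gBall (GG d) x r | v.1.2 ≠ 0} := by
    ext v
    simp only [mem_union, mem_ofPred_eq]
    tauto
  have h1 := count_up {v ∈ gBall (GG d) x r | v.1.2 = 0} (inj_zero _ 0 fun v hv => hv.2)
    (fun i => x.1.1 i - r) (2 * r + 1) fun v hv => hc v hv.1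
  have h2 := count_up {v ∈ gBall (GG d) x r | v.1.2 ≠ 0} (inj_pos hd _ fun v hv => hv.2)
    (fun i => x.1.1 i - r) (2 * r + 1) fun v hv => hc v hv.1
  rw [e]
  refine ⟨h1.1.union h2.1, (Set.ncard_union_le _ _).trans ?_⟩
  omega

lemma bdry_finite {d : ℕ} (hd : 2 ≤ d) (A : Set (VV d)) (hA : A.Finite) :
    (gBdry (GG d) A).Finite := by
  refine (hA.biUnion fun a _ => (ball_up hd a 1).1).subset ?_
  rintro y ⟨⟨a, ha, h⟩, -⟩
  simp only [mem_iUnion]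
  refine ⟨a, ha, ?_⟩
  change (GG d).dist a y ≤ 1
  rwa [SimpleGraph.dist_comm]

lemma GG_bddDegree {d : ℕ} (hd : 2 ≤ d) : BddDegree (GG d) := by
  refine ⟨2 * (2 * 1 + 1) ^ d, fun v => le_trans (Set.ncard_le_ncard ?_ (ball_up hd v 1).1)
    (ball_up hd v 1).2⟩
  intro y hy
  exact (SimpleGraph.dist_eq_one_iff_adj.mpr hy).le

lemma ball_low {d : ℕ} (hd : 2 ≤ d) (x : VV d) (r : ℕ) :
    (r / 4 + 1) ^ d ≤ (gBall (GG d) x r).ncard := by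
  have hfin := (ball_up hd x r).1
  by_cases hl : x.1.2 = 0
  · refine count_low _ hfin 0 (fun i => x.1.1 i) _ fun y hy => ⟨ok_zero y, ?_⟩
    obtain ⟨w, hw⟩ := dist_level x (bv y) hl r (by
      intro i
      have := hy i
      rw [abs_le]
      simp only [bv]
      push_cast at this
      omega)
    exact (SimpleGraph.dist_le w).trans hw
  · by_cases hr : 2 * ee d x.1.2 + 2 ≤ r
    · obtain ⟨w, hw⟩ := to_base hd x hl
      refine count_low _ hfin 0 (fun i => (ee d x.1.2 : ℤ)) _ fun y hy => ⟨ok_zero y, ?_⟩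
      obtain ⟨w', hw'⟩ := dist_base (fun _ => (ee d x.1.2 : ℤ)) y (r / 4) (by
        intro i
        have := hy i
        rw [abs_le]
        push_cast at this ⊢
        omega)
      refine (SimpleGraph.dist_le (w.append w')).trans ?_
      rw [Walk.length_append]
      omega
    · have hp := ee_pos d x.1.2 hd
      refine count_low _ hfin x.1.2 (fun i => max (ee d x.1.2 : ℤ) (x.1.1 i - (r / 4 : ℕ))) _
        fun y hy => ?_
      have hx := x.2 hl
      have hok : okV d (y, x.1.2) := by
        intro _ i
        have := hy i
        have := hx i
        push_cast at *
        omega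
      refine ⟨hok, ?_⟩
      obtain ⟨w, hw⟩ := dist_level x ⟨(y, x.1.2), hok⟩ rfl r (by
        intro i
        have := hy i
        have := hx i
        rw [abs_le]
        push_cast at *
        omega)
      exact (SimpleGraph.dist_le w).trans hw

lemma GG_growth {d : ℕ} (hd : 2 ≤ d) : PolyGrowth (GG d) d := by
  refine ⟨6 ^ d, one_le_pow₀ (by norm_num), fun x r hr => ⟨?_, ?_⟩⟩
  · have h := ball_low hd x r
    have h' : (((r / 4 + 1 : ℕ) : ℝ)) ^ d ≤ ((gBall (GG d) x r).ncard : ℝ) := by exact_mod_cast h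
    refine le_trans ?_ h'
    rw [← inv_pow, ← mul_pow]
    gcongr
    have : (r : ℝ) ≤ 6 * ((r / 4 + 1 : ℕ) : ℝ) := by
      exact_mod_cast (by omega : r ≤ 6 * (r / 4 + 1))
    linarith
  · have h := (ball_up hd x r).2
    have h' : ((gBall (GG d) x r).ncard : ℝ) ≤ 2 * (2 * r + 1) ^ d := by exact_mod_cast h
    refine h'.trans ?_
    have hr' : (1 : ℝ) ≤ r := by exact_mod_cast hr
    have h2 : (2 : ℝ) ≤ 2 ^ d := by
      calc (2 : ℝ) = 2 ^ 1 := by norm_num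
        _ ≤ 2 ^ d := pow_le_pow_right₀ (by norm_num) (by omega)
    calc (2 : ℝ) * (2 * r + 1) ^ d ≤ 2 ^ d * (3 * r) ^ d := by
          gcongr
          linarith
      _ = 6 ^ d * r ^ d := by rw [← mul_pow, ← mul_pow]; ring_nf

lemma proj_bound {d : ℕ} (S : Set (VV d)) (hS : S.Finite) (l K : ℕ) (hl : ∀ v ∈ S, v.1.2 = l)
    (h : ∀ i, ((fun v : VV d => v.1.1 i) '' S).ncard ≤ K) : S.ncard ≤ K ^ d := by
  classical
  let T : Fin d → Finset ℤ := fun i => (hS.image (fun v : VV d => v.1.1 i)).toFinset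
  have hT : ∀ i, (T i).card ≤ K := by
    intro i
    rw [← Set.ncard_coe_finset]
    simpa [T] using h i
  have h1 : S.ncard ≤ (Fintype.piFinset T).card := by
    rw [← Set.ncard_coe_finset]
    refine Set.ncard_le_ncard_of_injOn (fun v : VV d => v.1.1) ?_ (inj_zero S l hl)
      (Finset.finite_toSet _)
    intro v hv
    simp only [Finset.mem_coe, Fintype.mem_piFinset, T, Set.Finite.mem_toFinset]
    exact fun i => ⟨v, hv, rfl⟩
  refine h1.trans ?_
  rw [Fintype.card_piFinset]
  calc ∏ i, (T i).card ≤ ∏ _i : Fin d, K := Finset.prod_le_prod' fun i _ => hT i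
    _ = K ^ d := by simp

lemma exists_ne_fin {d : ℕ} (hd : 2 ≤ d) (i : Fin d) : ∃ j : Fin d, j ≠ i := by
  have : Nontrivial (Fin d) := Fin.nontrivial_iff_two_le.mpr hd
  exact exists_ne i

lemma iso_base {d : ℕ} (hd : 2 ≤ d) (A : Set (VV d)) (hA : A.Finite) :
    {v ∈ A | v.1.2 = 0}.ncard ≤ (gBdry (GG d) A).ncard ^ d := by
  classical
  have hS : {v ∈ A | v.1.2 = 0}.Finite := hA.subset fun v hv => hv.1
  refine proj_bound _ hS 0 _ (fun v hv => hv.2) fun i => ?_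
  have hfin := hS.image (fun v : VV d => v.1.1 i)
  rw [Set.ncard_eq_toFinset_card _ hfin]
  refine count_disj _ _ (bdry_finite hd A hA) (fun c v => v.1.1 i = c) ?_ ?_
  · intro c hc
    rw [Set.Finite.mem_toFinset] at hc
    obtain ⟨v, ⟨hvA, hv0⟩, hvc⟩ := hc
    by_contra hcon
    push Not at hcon
    obtain ⟨⟨x, l⟩, hx⟩ := v
    simp only at hv0 hvc
    subst hv0
    have hfill := box_fill (fun y : Fin d → ℤ => y i = c) (by
        intro x y z hx hy h
        have := h i
        omega) 0 (fun y _ => ok_zero y) A (fun z _ hz hzb => hcon z hzb hz) x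
    obtain ⟨j, hj⟩ := exists_ne_fin hd i
    refine Set.infinite_of_injective_forall_mem
      (f := fun k : ℤ => (bv (fun q => if q = i then c else k) : VV d)) ?_ (fun k => ?_) hA
    · intro k k' hk
      have := congrArg (fun v : VV d => v.1.1 j) hk
      simpa [bv, hj] using this
    · exact hfill _ hvc (by simp) hvA
  · intro t t' v h h'
    exact h.symm.trans h'

lemma iso_blob {d : ℕ} (hd : 2 ≤ d) (A : Set (VV d)) (hA : A.Finite) (m : ℕ) (hm : m ≠ 0)
    (hlt : (gBdry (GG d) A).ncard < m.factorial) :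
    {v ∈ A | v.1.2 = m}.ncard ≤ (gBdry (GG d) A).ncard ^ d := by
  classical
  have hS : {v ∈ A | v.1.2 = m}.Finite := hA.subset fun v hv => hv.1
  refine proj_bound _ hS m _ (fun v hv => hv.2) fun i => ?_
  have hfin := hS.image (fun v : VV d => v.1.1 i)
  rw [Set.ncard_eq_toFinset_card _ hfin]
  refine count_disj _ _ (bdry_finite hd A hA) (fun c v => v.1.1 i = c) ?_ ?_
  · intro c hc
    rw [Set.Finite.mem_toFinset] at hc
    obtain ⟨v, ⟨hvA, hv0⟩, hvc⟩ := hc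
    by_contra hcon
    push Not at hcon
    obtain ⟨⟨x, l⟩, hx⟩ := v
    simp only at hv0 hvc
    subst hv0
    have hfill := box_fill (fun y : Fin d → ℤ => okV d (y, l) ∧ y i = c) (by
        intro x y z hx hy h
        refine ⟨okBox_convex d l x y z hx.1 hy.1 h, ?_⟩
        have := h i
        have := hx.2
        have := hy.2
        omega) l (fun y hy => hy.1) A (fun z _ hz hzb => hcon z hzb hz.2) x
    refine absurd hlt (not_lt.mpr ?_)
    rw [← Finset.card_range l.factorial]
    obtain ⟨j, hj⟩ := exists_ne_fin hd i
    refine count_disj _ _ (bdry_finite hd A hA)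
      (fun t v => ∀ q, q ≠ i → v.1.1 q = (ee d l : ℤ) + t) ?_ ?_
    · intro t ht
      rw [Finset.mem_range] at ht
      by_contra hno
      push Not at hno
      have hdo := door_ok hd l t ht
      have hci := hx hm i
      simp only [hvc] at hci
      have hyok : okV d (fun q => if q = i then c else (ee d l : ℤ) + t, l) := by
        intro _ q
        have := hdo hm q
        simp only at this ⊢
        split_ifs
        · exact hci
        · exact this
      have hy := hfill (fun q => if q = i then c else (ee d l : ℤ) + t) ⟨hx, hvc⟩
        ⟨hyok, by simp⟩ hvA
      have hline : BoxConvex (fun y : Fin d → ℤ => ∀ q, q ≠ i → y q = (ee d l : ℤ) + t) := by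
        intro x y z hx hy h q hq
        have := h q
        have := hx q hq
        have := hy q hq
        omega
      have nb : ∀ z : VV d, (∀ q, q ≠ i → z.1.1 q = (ee d l : ℤ) + t) →
          z ∉ gBdry (GG d) A := by
        intro z hz hzb
        obtain ⟨q, hq, hq'⟩ := hno z hzb
        exact hq' (hz q hq)
      have hdoorA := box_fill (fun y : Fin d → ℤ => okV d (y, l) ∧
          ∀ q, q ≠ i → y q = (ee d l : ℤ) + t) (by
            intro x y z hx hy h
            exact ⟨okBox_convex d l x y z hx.1 hy.1 h, hline x y z hx.2 hy.2 h⟩) l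
          (fun y hy => hy.1) A (fun z _ hz => nb z hz.2) _ (fun _ => (ee d l : ℤ) + t)
          ⟨hyok, fun q hq => by simp [hq]⟩ ⟨hdo, fun q _ => rfl⟩ hy
      have hbase : bv (fun _ => (ee d l : ℤ) + t) ∈ A := by
        refine walk_bdry (GG d) A (Walk.cons (door_adj hd l t hm ht) Walk.nil) hdoorA ?_
        intro z hz
        apply nb
        intro q _
        simp at hz
        rcases hz with rfl | rfl <;> rfl
      have hfill0 := box_fill (fun y : Fin d → ℤ => ∀ q, q ≠ i → y q = (ee d l : ℤ) + t)
        hline 0 (fun y _ => ok_zero y) A (fun z _ hz => nb z hz) (fun _ => (ee d l : ℤ) + t)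
      refine Set.infinite_of_injective_forall_mem
        (f := fun k : ℤ => (bv (fun q => if q = i then k else (ee d l : ℤ) + t) : VV d))
        ?_ (fun k => ?_) hA
      · intro k k' hk
        have := congrArg (fun v : VV d => v.1.1 i) hk
        simpa [bv] using this
      · exact hfill0 _ (fun _ _ => rfl) (fun q hq => by simp [hq]) hbase
    · intro t t' v h h'
      have := h j hj
      have := h' j hj
      omega
  · intro t t' v h h'
    exact h.symm.trans h'

lemma gap_count {d : ℕ} (hd : 2 ≤ d) (A : Set (VV d)) (hA : A.Finite) (hc : gConn (GG d) A)
    (u w : VV d) (hu : u ∈ A) (hw : w ∈ A) (hw0 : w.1.2 ≠ 0) (hlt : w.1.2 < u.1.2) :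
    (u.1.2 + 1).factorial ^ d ≤ {v ∈ A | v.1.2 = 0}.ncard := by
  classical
  have hS : {v ∈ A | v.1.2 = 0}.Finite := hA.subset fun v hv => hv.1
  set K := (u.1.2 + 1).factorial ^ d with hK
  obtain ⟨m, hm⟩ : ∃ m, u.1.2 = m + 1 := ⟨u.1.2 - 1, by omega⟩
  have hgap := ee_gap d m u.1.2 hd (by omega)
  rw [← hK] at hgap
  let i0 : Fin d := ⟨0, by omega⟩
  have hui := (u.2 (by omega) i0).1
  have hwi := (w.2 hw0 i0).2
  have hwm := ee_mono d (show w.1.2 ≤ m by omega)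
  rw [← Finset.card_range K]
  refine count_disj _ _ hS (fun k v => (2 * ee d m + 10 * k : ℤ) ≤ v.1.1 i0 ∧
    v.1.1 i0 < (2 * ee d m + 10 * k + 10 : ℤ)) ?_ ?_
  · intro k hk
    rw [Finset.mem_range] at hk
    have hex : ∃ v ∈ A, (2 * ee d m + 10 * k : ℤ) ≤ v.1.1 i0 ∧
        v.1.1 i0 < (2 * ee d m + 10 * k + 10 : ℤ) := by
      by_contra hno
      push Not at hno
      have := hc {v ∈ A | v.1.1 i0 < (2 * ee d m + 10 * k : ℤ)}
        {v ∈ A | (2 * ee d m + 10 * k + 10 : ℤ) ≤ v.1.1 i0} (by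
          ext v
          simp only [mem_union, mem_ofPred_eq]
          constructor
          · intro hv
            rcases lt_or_ge (v.1.1 i0) (2 * ee d m + 10 * k : ℤ) with h | h
            · exact Or.inl ⟨hv, h⟩
            · exact Or.inr ⟨hv, hno v hv h⟩
          · rintro (h | h) <;> exact h.1) (by
          rw [Set.disjoint_left]
          rintro v ⟨-, h1⟩ ⟨-, h2⟩
          omega) (by
          rintro x ⟨-, h1⟩ y ⟨-, h2⟩
          have := dist_lip hd x y i0
          rw [abs_le] at this
          omega)
      rcases this with h | h
      · have : w ∈ (∅ : Set (VV d)) := by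
          rw [← h]
          exact ⟨hw, by omega⟩
        exact this
      · have : u ∈ (∅ : Set (VV d)) := by
          rw [← h]
          exact ⟨hu, by omega⟩
        exact this
    obtain ⟨v, hv, h1, h2⟩ := hex
    refine ⟨v, ⟨hv, ?_⟩, h1, h2⟩
    by_contra hv0
    have hvi := v.2 hv0 i0
    rcases le_or_gt v.1.2 m with h | h
    · have := ee_mono d h
      omega
    · have := ee_mono d (show u.1.2 ≤ v.1.2 by omega)
      omega
  · intro t t' v h h'
    omega

lemma conn_lower {d : ℕ} (hd : 2 ≤ d) (n : ℕ) (hn : n ≠ 0) (A : Set (VV d)) (hA : A.Finite)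
    (hc : gConn (GG d) A) (hcard : ee d n ^ d + (n + 1).factorial ^ d ≤ A.ncard) :
    (n + 1).factorial ≤ (gBdry (GG d) A).ncard := by
  by_contra hlt
  push Not at hlt
  have hb : (gBdry (GG d) A).ncard ^ d < (n + 1).factorial ^ d :=
    Nat.pow_lt_pow_left hlt (by omega)
  have hH := iso_base hd A hA
  have hU : A.ncard ≤ {v ∈ A | v.1.2 = 0}.ncard + {v ∈ A | v.1.2 ≠ 0}.ncard := by
    have e : A = {v ∈ A | v.1.2 = 0} ∪ {v ∈ A | v.1.2 ≠ 0} := by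
      ext v
      simp only [mem_union, mem_ofPred_eq]
      tauto
    conv_lhs => rw [e]
    exact Set.ncard_union_le _ _
  have hU' : ee d n ^ d < {v ∈ A | v.1.2 ≠ 0}.ncard := by omega
  obtain ⟨u, hu, hun⟩ : ∃ u ∈ A, n ≤ u.1.2 := by
    by_contra hno
    push Not at hno
    refine absurd (count_up {v ∈ A | v.1.2 ≠ 0} (inj_pos hd _ fun v hv => hv.2)
      (fun _ => 0) (ee d n) ?_).2 (not_le.mpr hU')
    rintro v ⟨hv, hv0⟩ i
    have h1 := v.2 hv0 i
    have h2 := ee_gap d _ _ hd (hno v hv)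
    omega
  have hall : ∀ w ∈ A, w.1.2 ≠ 0 → w.1.2 = u.1.2 := by
    intro w hw hw0
    by_contra hne
    have key : ∃ q, n ≤ q ∧ (q + 1).factorial ^ d ≤ {v ∈ A | v.1.2 = 0}.ncard := by
      rcases lt_or_gt_of_ne hne with h | h
      · exact ⟨_, hun, gap_count hd A hA hc u w hu hw hw0 h⟩
      · exact ⟨_, by omega, gap_count hd A hA hc w u hw hu (by omega) h⟩
    obtain ⟨q, hq, hq'⟩ := key
    have h1 : (n + 1).factorial ≤ (q + 1).factorial := Nat.factorial_le (by omega)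
    have h2 := Nat.pow_le_pow_left h1 d
    omega
  have hsub : {v ∈ A | v.1.2 ≠ 0} = {v ∈ A | v.1.2 = u.1.2} := by
    ext v
    simp only [mem_ofPred_eq]
    constructor
    · rintro ⟨h1, h2⟩
      exact ⟨h1, hall v h1 h2⟩
    · rintro ⟨h1, h2⟩
      exact ⟨h1, by omega⟩
  rcases hun.eq_or_lt with h | h
  · refine absurd (count_up {v ∈ A | v.1.2 ≠ 0} (inj_pos hd _ fun v hv => hv.2)
      (fun _ => ee d n) (ee d n) ?_).2 (not_le.mpr hU')
    rintro v ⟨hv, hv0⟩ i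
    have h1 := v.2 hv0 i
    rw [hall v hv hv0, ← h] at h1
    omega
  · have h1 : (n + 1).factorial ≤ u.1.2.factorial := Nat.factorial_le (by omega)
    have h2 := iso_blob hd A hA u.1.2 (by omega) (by omega)
    rw [← hsub] at h2
    have h3 : (n + 1).factorial ≤ ee d n :=
      (Nat.factorial_le (by omega)).trans (fac_le_ee d n hd)
    have h4 := Nat.pow_le_pow_left h3 d
    omega

/-- The blob of level `l`. -/
def blob (d l : ℕ) : Set (VV d) := {v | v.1.2 = l}

lemma blob_card {d : ℕ} (hd : 2 ≤ d) (l : ℕ) (hl : l ≠ 0) :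
    (blob d l).Finite ∧ ee d l ^ d ≤ (blob d l).ncard := by
  have hf : (blob d l).Finite := by
    refine (count_up (blob d l) (inj_zero _ l fun v hv => hv) (fun _ => ee d l) (ee d l) ?_).1
    intro v hv i
    have hv' : v.1.2 = l := hv
    have := v.2 (by omega) i
    rw [hv'] at this
    omega
  refine ⟨hf, count_low _ hf l (fun _ => ee d l) _ fun y hy => ⟨fun _ i => ?_, rfl⟩⟩
  have := hy i
  simp only
  omega

lemma adj_blob {d : ℕ} (u v : VV d) (l : ℕ) (hl : l ≠ 0) (hu : u.1.2 = l) (hv : v.1.2 ≠ l)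
    (h : (GG d).Adj u v) : v.1.2 = 0 ∧ u.1.1 = v.1.1 ∧ isDoor d u.1.1 l := by
  rcases h.2 with ⟨h1, -⟩ | ⟨h1, h2 | h2⟩
  · omega
  · omega
  · rw [hu] at h2
    exact ⟨h2.1, h1, h1 ▸ h2.2⟩

lemma profile_upper {d : ℕ} (hd : 2 ≤ d) (k : ℕ) :
    gProfile (GG d) (ee d (k + 2) ^ d + (k + 3).factorial ^ d) ≤ 4 * (k + 2).factorial := by
  classical
  obtain ⟨hf2, hc2⟩ := blob_card hd (k + 2) (by omega)
  obtain ⟨hf1, hc1⟩ := blob_card hd (k + 1) (by omega)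
  set A : Set (VV d) := blob d (k + 2) ∪ blob d (k + 1) with hA
  have hAf : A.Finite := hf2.union hf1
  have hdisj : Disjoint (blob d (k + 2)) (blob d (k + 1)) := by
    rw [Set.disjoint_left]
    intro v h1 h2
    have h1' : v.1.2 = k + 2 := h1
    have h2' : v.1.2 = k + 1 := h2
    omega
  have hAc : ee d (k + 2) ^ d + (k + 3).factorial ^ d ≤ A.ncard := by
    rw [hA, Set.ncard_union_eq hdisj hf2 hf1]
    have h := Nat.pow_le_pow_left (fac_le_ee d (k + 1) hd) d
    have e : k + 1 + 2 = k + 3 := rfl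
    rw [e] at h
    omega
  refine le_trans (Nat.sInf_le ⟨A, hAf, hAc, rfl⟩) ?_
  let F : Finset ((Fin d → ℤ) × ℕ) :=
    ((Finset.range (k + 2).factorial) ×ˢ (Finset.univ : Finset (Bool × Bool))).image
      fun p => (fun _ => ((ee d (if p.2.1 then k + 2 else k + 1) : ℕ) : ℤ) + p.1,
        if p.2.2 then 0 else (if p.2.1 then k + 2 else k + 1))
  have hF : F.card ≤ 4 * (k + 2).factorial := by
    refine Finset.card_image_le.trans ?_
    rw [Finset.card_product]
    simp
    omega
  have hdoorF : ∀ (x : Fin d → ℤ) (l : ℕ), (l = k + 2 ∨ l = k + 1) → isDoor d x l →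
      (x, l) ∈ F ∧ (x, 0) ∈ F := by
    rintro x l hl ⟨t, ht, hx⟩
    have ht' : t < (k + 2).factorial :=
      lt_of_lt_of_le ht (Nat.factorial_le (by omega))
    have hx' : x = fun _ => (ee d l : ℤ) + t := funext hx
    subst hx'
    simp only [F, Finset.mem_image, Finset.mem_product, Finset.mem_range, Finset.mem_univ,
      and_true]
    rcases hl with rfl | rfl
    · exact ⟨⟨(t, true, false), ht', by simp⟩, ⟨(t, true, true), ht', by simp⟩⟩
    · exact ⟨⟨(t, false, false), ht', by simp⟩, ⟨(t, false, true), ht', by simp⟩⟩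
  have hcross : ∀ a b : VV d, a ∈ A → b ∉ A → (GG d).dist a b ≤ 1 → a.1 ∈ F ∧ b.1 ∈ F := by
    intro a b ha hb hab
    have hne : a ≠ b := fun h => hb (h ▸ ha)
    have hpos := (GG_connected hd).pos_dist_of_ne hne
    have hadj : (GG d).Adj a b := SimpleGraph.dist_eq_one_iff_adj.mp (by omega)
    have hb' : b.1.2 ≠ k + 2 ∧ b.1.2 ≠ k + 1 :=
      ⟨fun h => hb (Or.inl h), fun h => hb (Or.inr h)⟩
    have ha' : a.1.2 = k + 2 ∨ a.1.2 = k + 1 := ha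
    have h := adj_blob a b a.1.2 (by omega) rfl (by omega) hadj
    have h2 := hdoorF a.1.1 a.1.2 ha' h.2.2
    refine ⟨h2.1, ?_⟩
    have e : b.1 = (a.1.1, 0) := Prod.ext h.2.1.symm h.1
    rw [e]
    exact h2.2
  refine le_trans ?_ hF
  rw [← Set.ncard_coe_finset]
  refine Set.ncard_le_ncard_of_injOn (fun v : VV d => v.1) ?_
    (fun u _ v _ h => Subtype.ext h) F.finite_toSet
  rintro y ⟨⟨a, ha, hya⟩, ⟨b, hb, hyb⟩⟩
  by_cases hy : y ∈ A
  · exact (hcross y b hy hb hyb).1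
  · rw [SimpleGraph.dist_comm] at hya
    exact (hcross a y ha hy hya).2

lemma ratio_bound {d : ℕ} (hd : 2 ≤ d) (k : ℕ) :
    (gProfile (GG d) (ee d (k + 2) ^ d + (k + 3).factorial ^ d) : ℝ) /
      (gConnProfile (GG d) (ee d (k + 2) ^ d + (k + 3).factorial ^ d) : ℝ) ≤
      4 / ((k : ℝ) + 1) := by
  have h1 := profile_upper hd k
  set N := ee d (k + 2) ^ d + (k + 3).factorial ^ d with hN
  rcases Nat.eq_zero_or_pos (gConnProfile (GG d) N) with h0 | h0
  · rw [h0]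
    simp
    positivity
  · have h2 : (k + 3).factorial ≤ gConnProfile (GG d) N := by
      have hne : {m : ℕ | ∃ A : Set (VV d), A.Finite ∧ gConn (GG d) A ∧ N ≤ A.ncard ∧
          (gBdry (GG d) A).ncard = m}.Nonempty := by
        by_contra hemp
        rw [Set.not_nonempty_iff_eq_empty] at hemp
        unfold gConnProfile at h0
        rw [hemp] at h0
        simp at h0
      obtain ⟨A, hA, hc, hcard, hb⟩ := Nat.sInf_mem hne
      have := conn_lower hd (k + 2) (by omega) A hA hc hcard
      exact this.trans hb.le
    have h3 : (k + 3).factorial = (k + 3) * (k + 2).factorial := rfl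
    have h4 : (gProfile (GG d) N : ℝ) ≤ 4 * ((k + 2).factorial : ℝ) := by exact_mod_cast h1
    have h5 : ((k : ℝ) + 3) * ((k + 2).factorial : ℝ) ≤ (gConnProfile (GG d) N : ℝ) := by
      exact_mod_cast h3 ▸ h2
    have h6 : (0 : ℝ) < ((k + 2).factorial : ℝ) := by exact_mod_cast Nat.factorial_pos _
    have h7 : (0 : ℝ) < (gConnProfile (GG d) N : ℝ) := by exact_mod_cast h0
    rw [div_le_div_iff₀ h7 (by positivity)]
    nlinarith [mul_le_mul_of_nonneg_right h4 (show (0 : ℝ) ≤ (k : ℝ) + 1 by positivity)]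

theorem exists_graph_connected_sets_not_isoperimetric (d : ℕ) (hd : 2 ≤ d) :
    ∃ (V : Type) (G : SimpleGraph V), Countable V ∧ Infinite V ∧
      G.Connected ∧ BddDegree G ∧ PolyGrowth G d ∧
      ∃ N : ℕ → ℕ, StrictMono N ∧
        Tendsto (fun n => (gProfile G (N n) : ℝ) / (gConnProfile G (N n) : ℝ))
          atTop (nhds 0) := by
  refine ⟨VV d, GG d, inferInstance, ?_, GG_connected hd, GG_bddDegree hd, GG_growth hd,
    fun k => ee d (k + 2) ^ d + (k + 3).factorial ^ d, ?_, ?_⟩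
  · refine Infinite.of_injective (fun k : ℤ => (bv (fun _ => k) : VV d)) ?_
    intro k k' h
    exact congrArg (fun v : VV d => v.1.1 ⟨0, by omega⟩) h
  · refine strictMono_nat_of_lt_succ fun k => ?_
    have h1 : ee d (k + 2) ^ d ≤ ee d (k + 1 + 2) ^ d :=
      Nat.pow_le_pow_left (ee_mono d (by omega)) d
    have h2 : (k + 3).factorial ^ d < (k + 1 + 3).factorial ^ d :=
      Nat.pow_lt_pow_left ((Nat.factorial_lt (by omega)).mpr (by omega)) (by omega)
    omega
  · have hlim : Tendsto (fun k : ℕ => (4 : ℝ) / ((k : ℝ) + 1)) atTop (nhds 0) :=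
      tendsto_const_nhds.div_atTop (tendsto_natCast_atTop_atTop.atTop_add tendsto_const_nhds)
    exact squeeze_zero (fun k => by positivity) (fun k => ratio_bound hd k) hlim
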